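/- Let k = 12ℓ + k' and write the Faber polynomial as F_{k,m}(t) = t^{ℓ−m} + e_1 t^{ℓ−m−1} + ⋯ + e_{ℓ−m}. Then for every n with 1 ≤ n ≤ ℓ − m, e_n = ∑_{t_1 + 2t_2 + ⋯ + n·t_n = n, t_s ≥ 0} ∏_{s=1}^n (−1)^{t_s} (A_s·k + B_s·m + C_s(k'))^{t_s} / (t_s! · s^{t_s}), where A_s = (1/2π)∫_{π/2}^{2π/3} j(e^{iθ})^s dθ, B_s = −c_s(0) with c_s(0) the coefficient of q^0 in j^s, C_s(k') = 0 for k' ∈ {0,4,8} and C_s(k') = −1728^s/2 for k' ∈ {6,10,14}. -/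

import Mathlib

open Complex Polynomial Real MeasureTheory Filter Topology

noncomputable section

/-- `q = e^{2πiz}`. -/
def qexp (z : ℂ) : ℂ := Complex.exp (2 * Real.pi * Complex.I * z)

/-- The normalized Eisenstein series `E_k(z) = (1/2) ∑_{gcd(c,d)=1} (cz+d)^{-k}`,
with the convention `E_0 = 1`. -/
def Eis (k : ℕ) (z : ℂ) : ℂ :=
  if k = 0 then 1
  else (1 / 2) * ∑' p : ℤ × ℤ, if Int.gcd p.1 p.2 = 1 then 1 / ((p.1 : ℂ) * z + (p.2 : ℂ)) ^ k else 0

/-- The modular discriminant `Δ(z) = q ∏_{n ≥ 1} (1 - q^n)^24`, `q = e^{2πiz}`. -/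
def Disc (z : ℂ) : ℂ := qexp z * ∏' n : ℕ, (1 - qexp z ^ (n + 1)) ^ 24

/-- The modular `j`-invariant `j = E₄³ / Δ`. -/
def jinv (z : ℂ) : ℂ := Eis 4 z ^ 3 / Disc z

/-- The coefficient of `q^d` in the Fourier/`q`-expansion of a `1`-periodic function
holomorphic on the upper half-plane, computed at height `1`. -/
def qCoeff (f : ℂ → ℂ) (d : ℤ) : ℂ :=
  ∫ x in (0:ℝ)..1,
    f (x + Complex.I) * Complex.exp (-(2 * Real.pi * Complex.I * d * (x + Complex.I)))

/-- `c_N(d)`: the coefficient of `q^d` in the Laurent expansion of `j^N`. -/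
def cj (N : ℕ) (d : ℤ) : ℂ := qCoeff (fun z => jinv z ^ N) d

/-- `A_n = (1/2π) ∫_{π/2}^{2π/3} j(e^{iθ})^n dθ`. -/
def Acoef (n : ℕ) : ℂ :=
  (1 / (2 * Real.pi)) *
    ∫ θ in (Real.pi / 2)..(2 * Real.pi / 3), jinv (Complex.exp (θ * Complex.I)) ^ n

/-- `B_n = -c_n(0)`, where `c_n(0)` is the coefficient of `q^0` in `j^n`. -/
def Bcoef (n : ℕ) : ℂ := - cj n 0

/-- `C_n(k') = 0` for `k' ∈ {0,4,8}` and `C_n(k') = -1728^n/2` for `k' ∈ {6,10,14}`. -/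
def Ccoef (n k' : ℕ) : ℂ := if k' = 6 ∨ k' = 10 ∨ k' = 14 then -(1728 : ℂ) ^ n / 2 else 0

/-- Real-valued version of `A_n` (recall `j` is real on the arc). -/
def AcoefR (n : ℕ) : ℝ :=
  (1 / (2 * Real.pi)) *
    ∫ θ in (Real.pi / 2)..(2 * Real.pi / 3), (jinv (Complex.exp (θ * Complex.I)) ^ n).re

/-- Real-valued version of `B_n = -c_n(0)` (recall `c_n(0)` is an integer). -/
def BcoefR (n : ℕ) : ℝ := - (cj n 0).re

/-- Real-valued version of `C_n(k')`. -/
def CcoefR (n k' : ℕ) : ℝ := if k' = 6 ∨ k' = 10 ∨ k' = 14 then -(1728 : ℝ) ^ n / 2 else 0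

/-- `f` is the `m`-th element `f_{k,m} = q^m + O(q^{ℓ+1})` of the Miller basis of `M_k`,
`k = 12ℓ + k'`: it is holomorphic on the upper half-plane, weight-`k` modular for
`SL₂(ℤ)`, and has a convergent `q`-expansion whose coefficients in degrees `≤ ℓ`
are `δ_{d,m}`. -/
def IsMillerForm (ℓ k' m : ℕ) (f : ℂ → ℂ) : Prop :=
  (∀ z : ℂ, 0 < z.im → DifferentiableAt ℂ f z) ∧
  (∀ z : ℂ, 0 < z.im → f (z + 1) = f z) ∧
  (∀ z : ℂ, 0 < z.im → f (-1 / z) = z ^ (12 * ℓ + k') * f z) ∧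
  (∃ a : ℕ → ℂ,
    (∀ z : ℂ, 0 < z.im →
      Summable (fun n : ℕ => a n * qexp z ^ n) ∧ f z = ∑' n : ℕ, a n * qexp z ^ n) ∧
    (∀ d : ℕ, d ≤ ℓ → a d = if d = m then 1 else 0))

/-- `F` is the Faber polynomial of `f = f_{k,m}`, `k = 12ℓ + k'`: the monic polynomial
of degree `ℓ - m` with `f = Δ^ℓ ⬝ E_{k'} ⬝ F(j)`. -/
def IsFaber (ℓ k' m : ℕ) (f : ℂ → ℂ) (F : Polynomial ℂ) : Prop :=
  F.Monic ∧ F.natDegree = ℓ - m ∧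
  ∀ z : ℂ, 0 < z.im → f z = Disc z ^ ℓ * Eis k' z * F.eval (jinv z)

/-- The sum of the `n`-th powers of the zeros of `F`, counted with multiplicity. -/
def powerSumRoots (F : Polynomial ℂ) (n : ℕ) : ℂ := (F.roots.map (fun x => x ^ n)).sum

/-- The (finite) solutions of `d_1 + 2 d_2 + ⋯ + n d_n = n` in nonnegative integers,
indexed by `Fin n` (so index `t : Fin n` stands for `d_{t+1}`).  Note any solution
automatically has `d_t ≤ n`. -/
def sols (n : ℕ) : Finset (Fin n → ℕ) :=
  (Fintype.piFinset fun _ : Fin n => Finset.range (n + 1)).filter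
    (fun d => ∑ t : Fin n, ((t : ℕ) + 1) * d t = n)

open UpperHalfPlane ModularForm EisensteinSeries MatrixGroups in
lemma Eis_eq_E {k : ℕ} (hk : 3 ≤ k) (z : ℍ) : Eis k (z : ℂ) = ModularForm.E hk z := by
  have h0 : k ≠ 0 := by omega
  rw [Eis, if_neg h0]
  change _ = ((1/2 : ℂ) • eisensteinSeries (0 : Fin 2 → ZMod 1) k) z
  rw [Pi.smul_apply, smul_eq_mul, eisensteinSeries]
  congr 1
  have : (fun v : gammaSet 1 1 (0 : Fin 2 → ZMod 1) => eisSummand k v z) = (fun v : Fin 2 → ℤ => eisSummand k v z) ∘ (Subtype.val) := rfl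
  rw [this]
  erw [tsum_subtype (gammaSet 1 1 (0 : Fin 2 → ZMod 1)) (fun v : Fin 2 → ℤ => eisSummand k v z)]
  rw [← (finTwoArrowEquiv ℤ).symm.tsum_eq]
  refine tsum_congr fun p => ?_
  have hmem : ((finTwoArrowEquiv ℤ).symm p ∈ gammaSet 1 1 (0 : Fin 2 → ZMod 1)) ↔ Int.gcd p.1 p.2 = 1 := by
    simp only [gammaSet, Set.mem_ofPred_eq]
    constructor
    · rintro ⟨_, h⟩; simpa using h
    · intro h; exact ⟨Subsingleton.elim _ _, by simpa using h⟩
  by_cases h : Int.gcd p.1 p.2 = 1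
  · rw [if_pos h, Set.indicator_of_mem (hmem.2 h)]
    simp [eisSummand]
  · rw [if_neg h, Set.indicator_of_notMem (fun h' => h (hmem.1 h'))]

lemma qexp_eq (z : ℂ) : qexp z = Function.Periodic.qParam 1 z := by
  simp [qexp, Function.Periodic.qParam]

open UpperHalfPlane ModularForm in
lemma Disc_eq (z : ℍ) : Disc (z : ℂ) = ModularForm.discriminant z := by
  rw [discriminant_eq_q_prod, Disc, qexp_eq]


open UpperHalfPlane ModularForm EisensteinSeries MatrixGroups in
lemma form_T {k : ℤ} (f : ModularForm 𝒮ℒ k) (g : ℂ → ℂ) (hg : ∀ z : ℍ, g z = f z)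
    (z : ℂ) (hz : 0 < z.im) : g (z + 1) = g z := by
  have hz1 : 0 < (z + 1).im := by simpa using hz
  have h := SlashInvariantForm.vAdd_apply_of_mem_strictPeriods f (⟨z, hz⟩ : ℍ)
    (h := 1) one_mem_strictPeriods_SL
  rw [← hg, ← hg] at h
  rw [← h]
  congr 1
  simp [add_comm]

open UpperHalfPlane ModularForm EisensteinSeries MatrixGroups in
lemma form_S {k : ℕ} (f : ModularForm 𝒮ℒ (k : ℤ)) (g : ℂ → ℂ) (hg : ∀ z : ℍ, g z = f z)
    (z : ℂ) (hz : 0 < z.im) : g (-1 / z) = z ^ k * g z := by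
  have h1 : (f : ℍ → ℂ) ∣[(k : ℤ)] ModularGroup.S = f :=
    SlashInvariantFormClass.slash_action_eq f _ ⟨_, rfl⟩
  have h := congrFun h1 ⟨z, hz⟩
  rw [SlashInvariantForm.slash_S_apply, ← hg, ← hg] at h
  have hz0 : z ≠ 0 := by rintro rfl; simp at hz
  simp only [] at h
  have e : (-1 / z) = (-z)⁻¹ := by
    field_simp
  rw [e, ← h]
  simp
  field_simp

open UpperHalfPlane ModularForm EisensteinSeries MatrixGroups in
lemma form_diff {k : ℤ} (f : ModularForm 𝒮ℒ k) (g : ℂ → ℂ) (hg : ∀ z : ℍ, g z = f z)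
    (z : ℂ) (hz : 0 < z.im) : DifferentiableAt ℂ g z := by
  have h := (UpperHalfPlane.mdifferentiable_iff.mp f.holo') z hz
  have h2 := h.differentiableAt (isOpen_upperHalfPlaneSet.mem_nhds hz)
  refine h2.congr_of_eventuallyEq ?_
  filter_upwards [isOpen_upperHalfPlaneSet.mem_nhds hz] with w hw
  have := hg ⟨w, hw⟩
  simp [ofComplex_apply_of_im_pos hw]
  exact this

open UpperHalfPlane ModularForm EisensteinSeries MatrixGroups in
lemma form_cusp {k : ℤ} (f : ModularForm 𝒮ℒ k) (g : ℂ → ℂ) (hg : ∀ z : ℍ, g z = f z) :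
    ∃ c : ℂ → ℂ, DifferentiableOn ℂ c (Metric.ball 0 1) ∧ c 0 = (qExpansion 1 f).coeff 0 ∧
      ∀ z : ℂ, 0 < z.im → g z = c (qexp z) := by
  have hper := SlashInvariantFormClass.periodic_comp_ofComplex f (h := 1) one_mem_strictPeriods_SL
  refine ⟨cuspFunction 1 f, differentiableOn_cuspFunction_ball one_pos hper f.holo' (ModularFormClass.bdd_at_infty f), ?_, ?_⟩
  · simp [qExpansion_coeff]
  · intro z hz
    rw [qexp_eq]
    have := eq_cuspFunction (⟨z, hz⟩ : ℍ) one_ne_zero hper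
    rw [← hg] at this
    exact this.symm

lemma Eis_T {k : ℕ} (hk : 3 ≤ k) (z : ℂ) (hz : 0 < z.im) : Eis k (z + 1) = Eis k z :=
  form_T _ _ (Eis_eq_E hk) z hz
lemma Eis_S {k : ℕ} (hk : 3 ≤ k) (z : ℂ) (hz : 0 < z.im) : Eis k (-1 / z) = z ^ k * Eis k z :=
  form_S _ _ (Eis_eq_E hk) z hz
lemma Eis_diff {k : ℕ} (hk : 3 ≤ k) (z : ℂ) (hz : 0 < z.im) : DifferentiableAt ℂ (Eis k) z :=
  form_diff _ _ (Eis_eq_E hk) z hz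

open UpperHalfPlane ModularForm EisensteinSeries MatrixGroups in
lemma Disc_form : ∃ f : ModularForm 𝒮ℒ ((12 : ℕ) : ℤ), ∀ z : ℍ, Disc z = f z :=
  ⟨(CuspForm.discriminant : ModularForm 𝒮ℒ 12), fun z => Disc_eq z⟩

lemma Disc_T (z : ℂ) (hz : 0 < z.im) : Disc (z + 1) = Disc z := by
  obtain ⟨f, hf⟩ := Disc_form
  exact form_T _ _ hf z hz
lemma Disc_S (z : ℂ) (hz : 0 < z.im) : Disc (-1 / z) = z ^ 12 * Disc z := by
  obtain ⟨f, hf⟩ := Disc_form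
  exact form_S _ _ hf z hz
lemma Disc_diff (z : ℂ) (hz : 0 < z.im) : DifferentiableAt ℂ Disc z := by
  obtain ⟨f, hf⟩ := Disc_form
  exact form_diff _ _ hf z hz
lemma Disc_ne (z : ℂ) (hz : 0 < z.im) : Disc z ≠ 0 := by
  rw [show z = ((⟨z, hz⟩ : UpperHalfPlane) : ℂ) from rfl, Disc_eq]
  exact ModularForm.discriminant_ne_zero _

lemma E6_sq (z : ℂ) (hz : 0 < z.im) : Eis 6 z ^ 2 = Eis 4 z ^ 3 - 1728 * Disc z := by
  rw [show z = ((⟨z, hz⟩ : UpperHalfPlane) : ℂ) from rfl, Disc_eq,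
    ModularForm.discriminant_eq_E₄_cube_sub_E₆_sq, Eis_eq_E (by norm_num : 3 ≤ 6),
    Eis_eq_E (by norm_num : 3 ≤ 4)]
  ring


open UpperHalfPlane ModularForm EisensteinSeries MatrixGroups in
lemma form_ext {k : ℕ} (f g : ModularForm 𝒮ℒ (k : ℤ))
    (h : ∀ i ≤ k / 12, (qExpansion 1 f).coeff i = (qExpansion 1 g).coeff i) : f = g := by
  rw [← sub_eq_zero]
  apply sturm_bound_levelOne_nat
  have : ((k / 12 + 1 : ℕ) : ℕ∞) ≤ (qExpansion 1 (f - g : ModularForm 𝒮ℒ (k : ℤ))).order := by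
    apply PowerSeries.nat_le_order
    intro i hi
    rw [FunLike.coe_sub, ModularForm.qExpansion_sub one_pos one_mem_strictPeriods_SL, map_sub,
      h i (by omega), sub_self]
  refine lt_of_lt_of_le ?_ this
  exact_mod_cast Nat.lt_succ_self _

open UpperHalfPlane ModularForm EisensteinSeries MatrixGroups in
lemma E8_eq (z : ℂ) (hz : 0 < z.im) : Eis 8 z = Eis 4 z ^ 2 := by
  have h : (E (by norm_num : 3 ≤ 8) : ModularForm 𝒮ℒ ((8 : ℕ) : ℤ)) =
      ModularForm.mcast (by norm_num) (E₄.pow 2) := by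
    apply form_ext
    intro i hi
    obtain rfl : i = 0 := by omega
    simp [coe_mcast, ModularForm.qExpansion_pow one_pos one_mem_strictPeriods_SL, pow_two,
      PowerSeries.coeff_mul, -PowerSeries.coeff_zero_eq_constantCoeff,
      E_qExpansion_coeff_zero _ (⟨2, rfl⟩ : Even 4), E_qExpansion_coeff_zero _ (⟨4, rfl⟩ : Even 8)]
  have h2 := DFunLike.congr_fun h ⟨z, hz⟩
  simp only [coe_mcast, ModularForm.coe_pow, Pi.pow_apply] at h2
  rw [← Eis_eq_E, ← Eis_eq_E] at h2
  exact h2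

open UpperHalfPlane ModularForm EisensteinSeries MatrixGroups in
lemma E10_eq (z : ℂ) (hz : 0 < z.im) : Eis 10 z = Eis 4 z * Eis 6 z := by
  have h : (E (by norm_num : 3 ≤ 10) : ModularForm 𝒮ℒ ((10 : ℕ) : ℤ)) =
      ModularForm.mcast (by norm_num) (E₄.mul E₆) := by
    apply form_ext
    intro i hi
    obtain rfl : i = 0 := by omega
    have e4 := E_qExpansion_coeff_zero (by norm_num : 3 ≤ 4) (⟨2, rfl⟩ : Even 4)
    have e6 := E_qExpansion_coeff_zero (by norm_num : 3 ≤ 6) (⟨3, rfl⟩ : Even 6)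
    have e10 := E_qExpansion_coeff_zero (by norm_num : 3 ≤ 10) (⟨5, rfl⟩ : Even 10)
    rw [e10, coe_mcast, ModularForm.coe_mul,
      ModularForm.qExpansion_mul_coe one_pos one_mem_strictPeriods_SL]
    simp [PowerSeries.coeff_mul, -PowerSeries.coeff_zero_eq_constantCoeff, e4, e6]
  have h2 := DFunLike.congr_fun h ⟨z, hz⟩
  simp only [coe_mcast, ModularForm.coe_mul, Pi.mul_apply] at h2
  rw [← Eis_eq_E, ← Eis_eq_E, ← Eis_eq_E] at h2
  exact h2

lemma bernoulli_fourteen : _root_.bernoulli 14 = 7 / 6 := by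
  have b2 := _root_.sum_bernoulli 3
  have b4 := _root_.sum_bernoulli 5
  have b6 := _root_.sum_bernoulli 7
  have b8 := _root_.sum_bernoulli 9
  have b10 := _root_.sum_bernoulli 11
  have b12 := _root_.sum_bernoulli 13
  have b14 := _root_.sum_bernoulli 15
  have o : ∀ n : ℕ, 1 ≤ n → _root_.bernoulli (2 * n + 1) = 0 := fun n hn =>
    bernoulli_eq_zero_of_odd ⟨n, rfl⟩ (by omega)
  have o3 : _root_.bernoulli 3 = 0 := o 1 (by norm_num)
  have o5 : _root_.bernoulli 5 = 0 := o 2 (by norm_num)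
  have o7 : _root_.bernoulli 7 = 0 := o 3 (by norm_num)
  have o9 : _root_.bernoulli 9 = 0 := o 4 (by norm_num)
  have o11 : _root_.bernoulli 11 = 0 := o 5 (by norm_num)
  have o13 : _root_.bernoulli 13 = 0 := o 6 (by norm_num)
  norm_num [Finset.sum_range_succ, Nat.choose, o3, o5, o7, o9, o11, o13] at b2 b4 b6 b8 b10 b12 b14
  linarith

open UpperHalfPlane ModularForm EisensteinSeries MatrixGroups in
lemma E14_eq (z : ℂ) (hz : 0 < z.im) : Eis 14 z = Eis 4 z ^ 2 * Eis 6 z := by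
  have h : (E (by norm_num : 3 ≤ 14) : ModularForm 𝒮ℒ ((14 : ℕ) : ℤ)) =
      ModularForm.mcast (by norm_num) ((E₄.mul E₄).mul E₆) := by
    apply form_ext
    intro i hi
    have e4 := E_qExpansion_coeff_zero (by norm_num : 3 ≤ 4) (⟨2, rfl⟩ : Even 4)
    have e6 := E_qExpansion_coeff_zero (by norm_num : 3 ≤ 6) (⟨3, rfl⟩ : Even 6)
    have e14 := E_qExpansion_coeff_zero (by norm_num : 3 ≤ 14) (⟨7, rfl⟩ : Even 14)
    have e14' : (qExpansion 1 (E (by norm_num : 3 ≤ 14))).coeff 1 = -24 := by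
      norm_num [E_qExpansion_coeff _ (⟨7, rfl⟩ : Even 14), bernoulli_fourteen]
    have hq : qExpansion 1 (ModularForm.mcast (by norm_num) ((E₄.mul E₄).mul E₆) : ModularForm 𝒮ℒ ((14 : ℕ) : ℤ))
        = qExpansion 1 E₄ * qExpansion 1 E₄ * qExpansion 1 E₆ := by
      rw [coe_mcast, ModularForm.coe_mul, ModularForm.qExpansion_mul_coe one_pos one_mem_strictPeriods_SL,
        ModularForm.coe_mul, ModularForm.qExpansion_mul_coe one_pos one_mem_strictPeriods_SL]
    rw [hq]
    have hi' : i = 0 ∨ i = 1 := by omega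
    rcases hi' with rfl | rfl
    · rw [e14]
      simp [PowerSeries.coeff_mul, -PowerSeries.coeff_zero_eq_constantCoeff, e4, e6]
    · rw [e14']
      norm_num [PowerSeries.coeff_mul, Finset.Nat.antidiagonal_succ, e4, e6, E₄_qExpansion_coeff_one,
        E₆_qExpansion_coeff_one, -PowerSeries.coeff_zero_eq_constantCoeff]
  have h2 := DFunLike.congr_fun h ⟨z, hz⟩
  simp only [coe_mcast, ModularForm.coe_mul, Pi.mul_apply] at h2
  rw [← Eis_eq_E, ← Eis_eq_E, ← Eis_eq_E] at h2
  rw [pow_two]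
  exact h2

/-- `j = H(q)/q` with `H` holomorphic on the unit disc and `H 0 = 1`. -/
lemma jinv_H : ∃ H : ℂ → ℂ, DifferentiableOn ℂ H (Metric.ball 0 1) ∧ H 0 = 1 ∧
    ∀ z : ℂ, 0 < z.im → jinv z = H (qexp z) / qexp z := by
  obtain ⟨c, hc, hc0, hcz⟩ := form_cusp _ _ (Eis_eq_E (by norm_num : 3 ≤ 4))
  have hP := ModularForm.differentiableOn_tprod_one_sub_pow_pow 24
  have hP0 : (∏' n : ℕ, (1 - (0:ℂ) ^ (n + 1)) ^ 24) = 1 := by simp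
  have hq0 : ∀ z, qexp z ≠ 0 := fun z => Complex.exp_ne_zero _
  refine ⟨fun q => c q ^ 3 / ∏' n : ℕ, (1 - q ^ (n + 1)) ^ 24, ?_, ?_, ?_⟩
  · refine (hc.pow 3).div hP ?_
    intro q hq
    by_cases h : q = 0
    · rw [h, hP0]; exact one_ne_zero
    · have him := Function.Periodic.im_invQParam_pos_of_norm_lt_one one_pos
        (by simpa [dist_zero_right] using hq) h
      have h2 := Disc_ne _ him
      rw [Disc, qexp_eq, Function.Periodic.qParam_right_inv one_ne_zero h] at h2
      exact right_ne_zero_of_mul h2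
  · simp only [hP0, hc0]
    rw [EisensteinSeries.E_qExpansion_coeff_zero _ (⟨2, rfl⟩ : Even 4)]
    norm_num
  · intro z hz
    rw [jinv, hcz z hz, Disc]
    have := Disc_ne z hz
    rw [Disc] at this
    have h2 := right_ne_zero_of_mul this
    have := hq0 z
    field_simp

lemma neg_inv_im {z : ℂ} (hz : 0 < z.im) : 0 < (-1 / z).im := by
  have := UpperHalfPlane.im_inv_neg_coe_pos ⟨z, hz⟩
  have e : (-1 / z) = (-z)⁻¹ := by field_simp
  rw [e]; exact this

lemma jinv_T (z : ℂ) (hz : 0 < z.im) : jinv (z + 1) = jinv z := by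
  rw [jinv, jinv, Eis_T (by norm_num) z hz, Disc_T z hz]

lemma jinv_S (z : ℂ) (hz : 0 < z.im) : jinv (-1 / z) = jinv z := by
  rw [jinv, jinv, Eis_S (by norm_num) z hz, Disc_S z hz]
  have hz0 : z ≠ 0 := by rintro rfl; simp at hz
  have := Disc_ne z hz
  field_simp

lemma jinv_diff (z : ℂ) (hz : 0 < z.im) : DifferentiableAt ℂ jinv z :=
  ((Eis_diff (by norm_num) z hz).pow 3).div (Disc_diff z hz) (Disc_ne z hz)

/-- Integral over one period at height `Y`. -/
def Lint (Y : ℝ) (g : ℂ → ℂ) : ℂ := ∫ x in (0:ℝ)..1, g (x + Y * Complex.I)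

lemma line_im (x Y : ℝ) : ((x : ℂ) + Y * Complex.I).im = Y := by simp

lemma line_cont {g : ℂ → ℂ} {Y : ℝ} (hd : ∀ z : ℂ, z.im = Y → ContinuousAt g z) :
    Continuous (fun x : ℝ => g ((x : ℂ) + Y * Complex.I)) := by
  rw [continuous_iff_continuousAt]
  intro x
  have : ContinuousAt (fun x : ℝ => (x : ℂ) + Y * Complex.I) x := by fun_prop
  exact ContinuousAt.comp (f := fun x : ℝ => (x : ℂ) + Y * Complex.I) (hd _ (line_im x Y)) this

lemma Lint_shift {g : ℂ → ℂ} {Y0 : ℝ} (hd : ∀ z : ℂ, Y0 < z.im → DifferentiableAt ℂ g z)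
    (hp : ∀ z : ℂ, Y0 < z.im → g (z + 1) = g z) {Y1 Y2 : ℝ} (h1 : Y0 < Y1) (h2 : Y0 < Y2) :
    Lint Y1 g = Lint Y2 g := by
  have h := Complex.integral_boundary_rect_eq_zero_of_differentiableOn g (Y1 * Complex.I) (1 + Y2 * Complex.I) (by
    intro z hz
    refine (hd z ?_).differentiableWithinAt
    have : z.im ∈ Set.uIcc Y1 Y2 := by
      have := hz.2
      simpa using this
    exact lt_of_lt_of_le (lt_min h1 h2) this.1)
  have e : (∫ y in Y1..Y2, g (1 + y * Complex.I)) = ∫ y in Y1..Y2, g (y * Complex.I) := by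
    apply intervalIntegral.integral_congr
    intro y hy
    have : Y0 < y := lt_of_lt_of_le (lt_min h1 h2) hy.1
    simp only []
    rw [add_comm, hp _ (by simpa using this)]
  simp at h
  rw [e] at h
  unfold Lint
  linear_combination h

lemma qexp_tendsto : Tendsto qexp (comap Complex.im atTop) (𝓝[≠] 0) := by
  have := Function.Periodic.qParam_tendsto (h := 1) one_pos
  convert this using 1
  ext z; exact qexp_eq z

lemma Lint_const {g : ℂ → ℂ} {Y0 : ℝ} (hd : ∀ z : ℂ, Y0 < z.im → DifferentiableAt ℂ g z)
    (hp : ∀ z : ℂ, Y0 < z.im → g (z + 1) = g z) {c : ℂ}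
    (hc : Tendsto g (comap Complex.im atTop) (𝓝 c)) {Y : ℝ} (hY : Y0 < Y) :
    Lint Y g = c := by
  by_contra hne
  have hpos : 0 < ‖Lint Y g - c‖ / 2 := by
    have : 0 < ‖Lint Y g - c‖ := norm_pos_iff.2 (sub_ne_zero.2 hne)
    linarith
  have hev := hc.eventually (Metric.ball_mem_nhds c hpos)
  rw [eventually_comap, ] at hev
  obtain ⟨Y', hY', hYY⟩ := (hev.and (eventually_gt_atTop Y)).exists
  have hY0' : Y0 < Y' := hY.trans hYY
  have hcont : Continuous (fun x : ℝ => g ((x : ℂ) + Y' * Complex.I)) :=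
    line_cont (fun z hz => (hd z (by rw [hz]; exact hY0')).continuousAt)
  have e : Lint Y g - c = ∫ x in (0:ℝ)..1, (g (x + Y' * Complex.I) - c) := by
    rw [Lint_shift hd hp hY hY0', intervalIntegral.integral_sub (hcont.intervalIntegrable _ _) (by simp)]
    simp [Lint]
  have hb : ‖Lint Y g - c‖ ≤ ‖Lint Y g - c‖ / 2 * |1 - 0| := by
    conv_lhs => rw [e]
    apply intervalIntegral.norm_integral_le_of_norm_le_const
    intro x _
    have := hY' (x + Y' * Complex.I) (line_im x Y')
    rw [dist_eq_norm] at this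
    exact this.le
  simp at hb
  linarith

lemma deriv_periodic {g : ℂ → ℂ} {Y0 : ℝ} 
    (hp : ∀ z : ℂ, Y0 < z.im → g (z + 1) = g z) (z : ℂ) (hz : Y0 < z.im) :
    deriv g (z + 1) = deriv g z := by
  rw [← deriv_comp_add_const]
  apply Filter.EventuallyEq.deriv_eq
  have : IsOpen {w : ℂ | Y0 < w.im} := isOpen_lt continuous_const Complex.continuous_im
  filter_upwards [this.mem_nhds hz] with w hw using hp w hw

lemma diff_deriv {g : ℂ → ℂ} {Y0 : ℝ} (hd : ∀ z : ℂ, Y0 < z.im → DifferentiableAt ℂ g z)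
    (z : ℂ) (hz : Y0 < z.im) : DifferentiableAt ℂ (deriv g) z := by
  have ho : IsOpen {w : ℂ | Y0 < w.im} := isOpen_lt continuous_const Complex.continuous_im
  have : DifferentiableOn ℂ g {w : ℂ | Y0 < w.im} := fun w hw => (hd w hw).differentiableWithinAt
  exact (this.deriv ho).differentiableAt (ho.mem_nhds hz)

lemma Lint_deriv {g : ℂ → ℂ} {Y0 : ℝ} (hd : ∀ z : ℂ, Y0 < z.im → DifferentiableAt ℂ g z)
    (hp : ∀ z : ℂ, Y0 < z.im → g (z + 1) = g z) {Y : ℝ} (hY : Y0 < Y) :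
    Lint Y (deriv g) = 0 := by
  unfold Lint
  have hcont : Continuous (fun x : ℝ => deriv g ((x : ℂ) + Y * Complex.I)) :=
    line_cont (fun z hz => (diff_deriv hd z (by rw [hz]; exact hY)).continuousAt)
  rw [intervalIntegral.integral_eq_sub_of_hasDerivAt (f := fun x : ℝ => g ((x : ℂ) + Y * Complex.I))
    (fun x _ => ?_) (hcont.intervalIntegrable _ _)]
  · have := hp (Y * Complex.I) (by simpa using hY)
    simp [add_comm] at this ⊢
    rw [this, sub_self]
  · have h1 := (hd (x + Y * Complex.I) (by rw [line_im]; exact hY)).hasDerivAt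
    have h2 : HasDerivAt (fun x : ℂ => x + Y * Complex.I) 1 (x : ℂ) := (hasDerivAt_id _).add_const _
    have h3 := (h1.comp (x : ℂ) h2).comp_ofReal
    simpa using h3

/-- Logarithmic derivative of the discriminant. -/
def Wd (z : ℂ) : ℂ := deriv Disc z / Disc z

lemma Wd_diff (z : ℂ) (hz : 0 < z.im) : DifferentiableAt ℂ Wd z :=
  (diff_deriv (Y0 := 0) Disc_diff z hz).div (Disc_diff z hz) (Disc_ne z hz)

lemma Wd_T (z : ℂ) (hz : 0 < z.im) : Wd (z + 1) = Wd z := by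
  rw [Wd, Wd, deriv_periodic (Y0 := 0) Disc_T z hz, Disc_T z hz]

lemma uhp_nhds {z : ℂ} (hz : 0 < z.im) : {w : ℂ | 0 < w.im} ∈ 𝓝 z :=
  (isOpen_lt continuous_const Complex.continuous_im).mem_nhds hz

lemma hasDerivAt_neg_inv {z : ℂ} (hz0 : z ≠ 0) :
    HasDerivAt (fun w : ℂ => -1 / w) (1 / z ^ 2) z := by
  have := (hasDerivAt_inv hz0).const_mul (-1)
  have h2 : HasDerivAt (fun w : ℂ => -1 / w) (-1 * -(z ^ 2)⁻¹) z := by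
    simpa only [div_eq_mul_inv] using this
  exact h2.congr_deriv (by simp)

lemma Wd_S (z : ℂ) (hz : 0 < z.im) : Wd (-1 / z) * (1 / z ^ 2) = 12 / z + Wd z := by
  have hz0 : z ≠ 0 := by rintro rfl; simp at hz
  have h1 := hasDerivAt_neg_inv hz0
  have h2 := (Disc_diff _ (neg_inv_im hz)).hasDerivAt.comp z h1
  have h3 : HasDerivAt (fun w => w ^ 12 * Disc w) _ z :=
    (hasDerivAt_pow 12 z).mul (Disc_diff z hz).hasDerivAt
  have e : (Disc ∘ fun w : ℂ => -1 / w) =ᶠ[𝓝 z] (fun w => w ^ 12 * Disc w) := by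
    filter_upwards [uhp_nhds hz] with w hw using Disc_S w hw
  have h4 := (h2.congr_of_eventuallyEq e.symm).unique h3
  have hD := Disc_ne z hz
  rw [Wd, Wd, Disc_S z hz, div_mul_eq_mul_div, h4]
  field_simp
  norm_num
  ring

lemma arc_im {θ : ℝ} (h1 : π / 2 ≤ θ) (h2 : θ ≤ 2 * π / 3) :
    1 / 4 < (Complex.exp (θ * Complex.I)).im := by
  rw [Complex.exp_ofReal_mul_I_im]
  have : Real.sin (π - θ) ≥ Real.sin (π / 6) := by
    apply Real.sin_le_sin_of_le_of_le_pi_div_two <;> linarith [Real.pi_pos]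
  rw [Real.sin_pi_sub, Real.sin_pi_div_six] at this
  linarith

lemma arc_neg_inv (θ : ℝ) : -1 / Complex.exp (θ * Complex.I) =
    Complex.exp ((π - θ : ℝ) * Complex.I) := by
  push_cast
  rw [sub_mul, Complex.exp_sub, Complex.exp_pi_mul_I]

lemma arc_ball (θ : ℝ) (h : 1 / 4 < (Complex.exp (θ * Complex.I)).im) :
    Complex.exp (θ * Complex.I) ∈ Metric.ball (2 * Complex.I) 2 := by
  rw [mem_ball_iff_norm, ← sq_lt_sq₀ (norm_nonneg _) (by norm_num), Complex.sq_norm,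
    Complex.normSq_apply]
  simp only [Complex.exp_ofReal_mul_I_im, Complex.exp_ofReal_mul_I_re, Complex.sub_re,
    Complex.sub_im] at h ⊢
  simp
  nlinarith [Real.sin_sq_add_cos_sq θ]

lemma vert_ball (x y : ℝ) (hx : x ^ 2 ≤ 1 / 4) (hy : 1 / 2 ≤ y) (hy1 : y ≤ 1) :
    (x : ℂ) + y * Complex.I ∈ Metric.ball (2 * Complex.I) 2 := by
  rw [mem_ball_iff_norm, ← sq_lt_sq₀ (norm_nonneg _) (by norm_num), Complex.sq_norm,
    Complex.normSq_apply]
  simp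
  nlinarith

lemma ball_uhp {z : ℂ} (hz : z ∈ Metric.ball (2 * Complex.I) 2) : 0 < z.im := by
  rw [mem_ball_iff_norm] at hz
  have := (Complex.abs_im_le_norm (z - 2 * Complex.I)).trans_lt hz
  rw [abs_lt] at this
  simp at this
  linarith

lemma rho_eq : Complex.exp ((2 * π / 3 : ℝ) * Complex.I) =
    ((-1 / 2 : ℝ) : ℂ) + ((√3 / 2 : ℝ) : ℂ) * Complex.I := by
  have e : 2 * π / 3 = π - π / 3 := by ring
  apply Complex.ext
  · rw [Complex.exp_ofReal_mul_I_re, e, Real.cos_pi_sub, Real.cos_pi_div_three]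
    simp; norm_num
  · rw [Complex.exp_ofReal_mul_I_im, e, Real.sin_pi_sub, Real.sin_pi_div_three]
    simp

lemma rho_eq2 : Complex.exp ((π / 3 : ℝ) * Complex.I) =
    ((-1 / 2 : ℝ) : ℂ) + ((√3 / 2 : ℝ) : ℂ) * Complex.I + 1 := by
  apply Complex.ext
  · rw [Complex.exp_ofReal_mul_I_re, Real.cos_pi_div_three]
    simp; norm_num
  · rw [Complex.exp_ofReal_mul_I_im, Real.sin_pi_div_three]
    simp

lemma Lint_Wd (s : ℕ) : Lint 1 (fun z => jinv z ^ s * Wd z) = 24 * π * Complex.I * Acoef s := by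
  set g : ℂ → ℂ := fun z => jinv z ^ s * Wd z with hg
  have gd : ∀ z : ℂ, 0 < z.im → DifferentiableAt ℂ g z := fun z hz =>
    ((jinv_diff z hz).pow s).mul (Wd_diff z hz)
  have gT : ∀ z : ℂ, 0 < z.im → g (z + 1) = g z := fun z hz => by
    simp only [hg, jinv_T z hz, Wd_T z hz]
  have hdo : DifferentiableOn ℂ g (Metric.ball (2 * Complex.I) 2) := fun z hz =>
    (gd z (ball_uhp hz)).differentiableWithinAt
  obtain ⟨G, hG⟩ := hdo.isExactOn_ball
  have hG' : ∀ z ∈ Metric.ball (2 * Complex.I) 2, HasDerivAt G (g z) z := hG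
  have s3 : (1 : ℝ) / 2 ≤ √3 / 2 := by
    have : (1 : ℝ) ≤ √3 := by rw [Real.le_sqrt'] <;> norm_num
    linarith
  have s3' : √3 / 2 ≤ 1 := by
    have : √3 ≤ 2 := by rw [Real.sqrt_le_left] <;> norm_num
    linarith
  -- top segment
  have top : Lint 1 g = G (((1 / 2 : ℝ) : ℂ) + ((1 : ℝ) : ℂ) * Complex.I)
      - G (((-1 / 2 : ℝ) : ℂ) + ((1 : ℝ) : ℂ) * Complex.I) := by
    have hper : Function.Periodic (fun x : ℝ => g ((x : ℂ) + (1 : ℝ) * Complex.I)) 1 := by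
      intro x
      have := gT ((x : ℂ) + (1 : ℝ) * Complex.I) (by simp)
      simp only []
      rw [← this]; congr 1; push_cast; ring
    have h1 := hper.intervalIntegral_add_eq 0 (-1 / 2)
    rw [zero_add, show (-1 / 2 : ℝ) + 1 = 1 / 2 by norm_num] at h1
    unfold Lint
    rw [h1]
    have hcont : Continuous (fun x : ℝ => g ((x : ℂ) + (1 : ℝ) * Complex.I)) :=
      line_cont (fun z hz => (gd z (by rw [hz]; norm_num)).continuousAt)
    rw [intervalIntegral.integral_eq_sub_of_hasDerivAt
      (f := fun x : ℝ => G ((x : ℂ) + (1 : ℝ) * Complex.I)) (fun x hx => ?_)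
      (hcont.intervalIntegrable _ _)]
    rw [Set.uIcc_of_le (by norm_num)] at hx
    have h1 := hG' (x + (1 : ℝ) * Complex.I) (vert_ball x 1 (by nlinarith [hx.1, hx.2]) (by norm_num) le_rfl)
    have h2 : HasDerivAt (fun x : ℂ => x + (1 : ℝ) * Complex.I) 1 (x : ℂ) :=
      (hasDerivAt_id _).add_const _
    have h3 := (h1.comp (x : ℂ) h2).comp_ofReal
    simpa using h3
  -- vertical segments
  have vert : G (((-1 / 2 : ℝ) : ℂ) + ((1 : ℝ) : ℂ) * Complex.I + 1)
      - G (((-1 / 2 : ℝ) : ℂ) + ((1 : ℝ) : ℂ) * Complex.I) =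
      G (((-1 / 2 : ℝ) : ℂ) + ((√3 / 2 : ℝ) : ℂ) * Complex.I + 1)
      - G (((-1 / 2 : ℝ) : ℂ) + ((√3 / 2 : ℝ) : ℂ) * Complex.I) := by
    have := intervalIntegral.integral_eq_sub_of_hasDerivAt (a := √3 / 2) (b := 1)
      (f := fun y : ℝ => G (((-1 / 2 : ℝ) : ℂ) + (y : ℂ) * Complex.I + 1)
        - G (((-1 / 2 : ℝ) : ℂ) + (y : ℂ) * Complex.I)) (f' := fun _ => 0) (fun y hy => ?_) (by simp)
    · simp only [intervalIntegral.integral_zero] at this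
      exact (sub_eq_zero.1 this.symm)
    · rw [Set.uIcc_of_le s3'] at hy
      have b1 := vert_ball (-1 / 2) y (by norm_num) (s3.trans hy.1) hy.2
      have b2 := vert_ball (1 / 2) y (by norm_num) (s3.trans hy.1) hy.2
      have e : ((1 / 2 : ℝ) : ℂ) + (y : ℂ) * Complex.I = ((-1 / 2 : ℝ) : ℂ) + (y : ℂ) * Complex.I + 1 := by
        push_cast; ring
      rw [e] at b2
      have h2 : HasDerivAt (fun y : ℂ => ((-1 / 2 : ℝ) : ℂ) + y * Complex.I) Complex.I (y : ℂ) := by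
        simpa using ((hasDerivAt_id (y : ℂ)).mul_const Complex.I).const_add ((-1 / 2 : ℝ) : ℂ)
      have h3 := ((hG' _ b2).comp (y : ℂ) (h2.add_const 1)).comp_ofReal
      have h4 := ((hG' _ b1).comp (y : ℂ) h2).comp_ofReal
      have h5 := h3.sub h4
      rw [gT _ (ball_uhp b1), sub_self] at h5
      exact h5
  -- arc
  have arc : (∫ θ in (π / 2)..(2 * π / 3), 12 * Complex.I * jinv (Complex.exp (θ * Complex.I)) ^ s)
      = G (((-1 / 2 : ℝ) : ℂ) + ((√3 / 2 : ℝ) : ℂ) * Complex.I + 1)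
      - G (((-1 / 2 : ℝ) : ℂ) + ((√3 / 2 : ℝ) : ℂ) * Complex.I) := by
    have hle : π / 2 ≤ 2 * π / 3 := by linarith [Real.pi_pos]
    rw [intervalIntegral.integral_eq_sub_of_hasDerivAt
      (f := fun θ : ℝ => G (-1 / Complex.exp (θ * Complex.I)) - G (Complex.exp (θ * Complex.I)))
      (fun θ hθ => ?_) ?_]
    · simp only [arc_neg_inv]
      rw [show π - π / 2 = π / 2 by ring, show π - 2 * π / 3 = π / 3 by ring, rho_eq, rho_eq2]
      ring
    · apply ContinuousOn.intervalIntegrable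
      rw [Set.uIcc_of_le hle]
      intro θ hθ
      have i1 := arc_im hθ.1 hθ.2
      have c1 := (jinv_diff _ (lt_trans (by norm_num) i1)).continuousAt
      have c2 : ContinuousAt (fun θ : ℝ => Complex.exp (θ * Complex.I)) θ := by fun_prop
      have c3 := ContinuousAt.comp (f := fun θ : ℝ => Complex.exp (θ * Complex.I)) c1 c2
      exact (continuousAt_const.mul (c3.pow s)).continuousWithinAt
    · rw [Set.uIcc_of_le hle] at hθ
      have i1 := arc_im hθ.1 hθ.2
      have b1 := arc_ball θ i1
      have b2 := arc_ball (π - θ) (by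
        rw [Complex.exp_ofReal_mul_I_im, Real.sin_pi_sub]
        rwa [Complex.exp_ofReal_mul_I_im] at i1)
      rw [← arc_neg_inv] at b2
      have u1 := ball_uhp b1
      have h2 : HasDerivAt (fun y : ℂ => Complex.exp (y * Complex.I))
          (Complex.exp (θ * Complex.I) * Complex.I) (θ : ℂ) := by
        simpa using ((hasDerivAt_id (θ : ℂ)).mul_const Complex.I).cexp
      have hE : Complex.exp (θ * Complex.I) ≠ 0 := Complex.exp_ne_zero _
      have h1 := hasDerivAt_neg_inv hE
      have h3 := ((hG' _ b2).comp (θ : ℂ) (h1.comp (θ : ℂ) h2)).comp_ofReal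
      have h4 := ((hG' _ b1).comp (θ : ℂ) h2).comp_ofReal
      have h5 := h3.sub h4
      refine HasDerivAt.congr_deriv h5 ?_
      have hw := Wd_S _ u1
      simp only [hg, jinv_S _ u1]
      generalize jinv (Complex.exp (θ * Complex.I)) ^ s = J at *
      generalize Complex.exp (θ * Complex.I) = E at *
      have : Wd (-1 / E) * (1 / E ^ 2) * E = 12 + Wd E * E := by
        rw [hw]; field_simp
      linear_combination (J * Complex.I) * this
  rw [top, show ((1 / 2 : ℝ) : ℂ) + ((1 : ℝ) : ℂ) * Complex.I
    = ((-1 / 2 : ℝ) : ℂ) + ((1 : ℝ) : ℂ) * Complex.I + 1 by push_cast; ring, vert, ← arc,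
    intervalIntegral.integral_const_mul, Acoef]
  have : (π : ℂ) ≠ 0 := by exact_mod_cast Real.pi_ne_zero
  field_simp
  ring

lemma im_gt_eventually (Y : ℝ) : ∀ᶠ z in comap Complex.im atTop, Y < z.im :=
  tendsto_comap.eventually (eventually_gt_atTop Y)

lemma qexp_ne (z : ℂ) : qexp z ≠ 0 := Complex.exp_ne_zero _

lemma qexp_deriv (z : ℂ) : HasDerivAt qexp (2 * π * Complex.I * qexp z) z := by
  have := ((hasDerivAt_id z).const_mul (2 * π * Complex.I)).cexp
  refine HasDerivAt.congr_deriv this ?_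
  simp [qexp, mul_comm]

lemma qexp_norm (z : ℂ) : ‖qexp z‖ = Real.exp (-(2 * π * z.im)) := by
  rw [qexp, Complex.norm_exp]; simp

lemma qexp_norm_lt {z : ℂ} {Y : ℝ} (h : Y < z.im) : ‖qexp z‖ < Real.exp (-(2 * π * Y)) := by
  rw [qexp_norm, Real.exp_lt_exp]
  nlinarith [Real.pi_pos]

lemma qexp_ball {z : ℂ} (h : 0 < z.im) : qexp z ∈ Metric.ball (0 : ℂ) 1 := by
  have := qexp_norm_lt h
  simpa using this

lemma tendsto_of_q {g Φ : ℂ → ℂ} (hΦ : ContinuousAt Φ 0) (Y : ℝ)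
    (h : ∀ z : ℂ, Y < z.im → g z = Φ (qexp z)) :
    Tendsto g (comap Complex.im atTop) (𝓝 (Φ 0)) := by
  have h1 : Tendsto qexp (comap Complex.im atTop) (𝓝 0) :=
    qexp_tendsto.mono_right nhdsWithin_le_nhds
  refine (hΦ.tendsto.comp h1).congr' ?_
  filter_upwards [im_gt_eventually Y] with z hz using (h z hz).symm

lemma Lint_add {Y : ℝ} {g h : ℂ → ℂ} (hg : ∀ z : ℂ, z.im = Y → ContinuousAt g z)
    (hh : ∀ z : ℂ, z.im = Y → ContinuousAt h z) :
    Lint Y (fun z => g z + h z) = Lint Y g + Lint Y h := by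
  unfold Lint
  exact intervalIntegral.integral_add ((line_cont hg).intervalIntegrable _ _)
    ((line_cont hh).intervalIntegrable _ _)

lemma Lint_smul {Y : ℝ} (c : ℂ) (g : ℂ → ℂ) :
    Lint Y (fun z => c * g z) = c * Lint Y g := by
  unfold Lint
  exact intervalIntegral.integral_const_mul _ _

lemma Lint_congr {Y : ℝ} {g h : ℂ → ℂ} (e : ∀ z : ℂ, z.im = Y → g z = h z) :
    Lint Y g = Lint Y h := by
  unfold Lint
  apply intervalIntegral.integral_congr
  intro x _
  exact e _ (line_im x Y)

lemma deriv_pow_j {z : ℂ} (hz : 0 < z.im) (s : ℕ) :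
    deriv (fun z => jinv z ^ (s + 1)) z = (s + 1) * (jinv z ^ s * deriv jinv z) := by
  have := ((jinv_diff z hz).hasDerivAt.pow (s + 1)).deriv
  rw [show (fun z => jinv z ^ (s + 1)) = jinv ^ (s + 1) from rfl, this]
  push_cast
  ring

lemma jlog_tendsto (x : ℂ) :
    Tendsto (fun z => deriv jinv z / (jinv z - x)) (comap Complex.im atTop)
      (𝓝 (-(2 * π * Complex.I))) := by
  obtain ⟨H, hH, H0, hj⟩ := jinv_H
  have hb : Metric.ball (0 : ℂ) 1 ∈ 𝓝 (0 : ℂ) := Metric.ball_mem_nhds _ one_pos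
  have hHc : ContinuousAt H 0 := (hH.differentiableAt hb).continuousAt
  have hH'c : ContinuousAt (deriv H) 0 :=
    ((hH.deriv Metric.isOpen_ball).differentiableAt hb).continuousAt
  have hc : ContinuousAt (fun w => 2 * π * Complex.I * (w * deriv H w - H w) / (H w - x * w)) 0 := by
    apply ContinuousAt.div
    · fun_prop
    · fun_prop
    · simp [H0]
  have := tendsto_of_q (g := fun z => deriv jinv z / (jinv z - x)) hc 0 (fun z hz => ?_)
  · simpa [H0] using this
  · have hq := qexp_ne z
    have hder : HasDerivAt (fun z => H (qexp z) / qexp z) _ z :=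
      (((hH.differentiableAt (Metric.isOpen_ball.mem_nhds (qexp_ball hz))).hasDerivAt.comp z
        (qexp_deriv z)).div (qexp_deriv z) hq)
    have e : jinv =ᶠ[𝓝 z] (fun z => H (qexp z) / qexp z) := by
      filter_upwards [uhp_nhds hz] with w hw using hj w hw
    rw [e.deriv_eq, hder.deriv, hj z hz]
    simp only [Function.comp_apply]
    have e2 : H (qexp z) / qexp z - x = (H (qexp z) - x * qexp z) / qexp z := by
      field_simp
    rw [e2]
    generalize H (qexp z) - x * qexp z = D
    field_simp

lemma Lint_root (x : ℂ) {Y0 Y : ℝ} (h0 : 0 ≤ Y0) (hY : Y0 < Y)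
    (hx : ∀ z : ℂ, Y0 < z.im → jinv z ≠ x) (s : ℕ) :
    Lint Y (fun z => jinv z ^ s * (deriv jinv z / (jinv z - x))) = -(2 * π * Complex.I) * x ^ s := by
  have hd : ∀ z : ℂ, Y0 < z.im → DifferentiableAt ℂ (fun z => deriv jinv z / (jinv z - x)) z :=
    fun z hz => (diff_deriv (Y0 := 0) jinv_diff z (h0.trans_lt hz)).div
      ((jinv_diff z (h0.trans_lt hz)).sub_const x) (sub_ne_zero.2 (hx z hz))
  induction s with
  | zero =>
    simp only [pow_zero, one_mul, mul_one]
    apply Lint_const hd _ (jlog_tendsto x) hY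
    intro z hz
    rw [jinv_T z (h0.trans_lt hz), deriv_periodic (Y0 := 0) jinv_T z (h0.trans_lt hz)]
  | succ s ih =>
    have hY' := h0.trans_lt hY
    have hjc : ∀ z : ℂ, z.im = Y → DifferentiableAt ℂ jinv z := fun z hz => jinv_diff z (by rw [hz]; exact hY')
    have e : Lint Y (fun z => jinv z ^ (s + 1) * (deriv jinv z / (jinv z - x)))
        = Lint Y (fun z => (1 / (s + 1) : ℂ) * deriv (fun z => jinv z ^ (s + 1)) z
          + x * (jinv z ^ s * (deriv jinv z / (jinv z - x)))) := by
      apply Lint_congr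
      intro z hz
      have h1 := sub_ne_zero.2 (hx z (by rw [hz]; exact hY))
      rw [deriv_pow_j (by rw [hz]; exact hY')]
      have : (s + 1 : ℂ) ≠ 0 := by exact_mod_cast Nat.succ_ne_zero s
      field_simp
      ring
    rw [e, Lint_add, Lint_smul, Lint_smul, ih, Lint_deriv (Y0 := 0) _ _ hY']
    · ring
    · intro z hz; exact (jinv_diff z hz).pow _
    · intro z hz; simp only [jinv_T z hz]
    · intro z hz
      exact (continuousAt_const.mul (diff_deriv (Y0 := 0)
        (fun z hz => (jinv_diff z hz).pow (s + 1)) z (by rw [hz]; exact hY')).continuousAt)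
    · intro z hz
      exact continuousAt_const.mul (((hjc z hz).continuousAt.pow s).mul
        (hd z (by rw [hz]; exact hY)).continuousAt)

lemma Lint_roots {Y0 Y : ℝ} (h0 : 0 ≤ Y0) (hY : Y0 < Y) (s : ℕ) (S : Multiset ℂ)
    (hx : ∀ x ∈ S, ∀ z : ℂ, Y0 < z.im → jinv z ≠ x) :
    (∀ z : ℂ, z.im = Y → ContinuousAt
      (fun z => (S.map fun x => jinv z ^ s * (deriv jinv z / (jinv z - x))).sum) z) ∧
    Lint Y (fun z => (S.map fun x => jinv z ^ s * (deriv jinv z / (jinv z - x))).sum)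
      = -(2 * π * Complex.I) * (S.map fun x => x ^ s).sum := by
  induction S using Multiset.induction_on with
  | empty => simp [Lint, continuousAt_const]
  | cons x S ih =>
    obtain ⟨ih1, ih2⟩ := ih (fun y hy => hx y (Multiset.mem_cons_of_mem hy))
    have hx' := hx x (Multiset.mem_cons_self x S)
    have hc : ∀ z : ℂ, z.im = Y → ContinuousAt
        (fun z => jinv z ^ s * (deriv jinv z / (jinv z - x))) z := by
      intro z hz
      have hz0 : 0 < z.im := by rw [hz]; exact h0.trans_lt hY
      exact (((jinv_diff z hz0).pow s).mul ((diff_deriv (Y0 := 0) jinv_diff z hz0).div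
        ((jinv_diff z hz0).sub_const x)
        (sub_ne_zero.2 (hx' z (by rw [hz]; exact hY))))).continuousAt
    simp only [Multiset.map_cons, Multiset.sum_cons]
    refine ⟨fun z hz => (hc z hz).add (ih1 z hz), ?_⟩
    rw [Lint_add hc ih1, Lint_root x h0 hY hx' s, ih2]
    ring

lemma Lint_poly {Y0 Y : ℝ} (h0 : 0 ≤ Y0) (hY : Y0 < Y) (s : ℕ) (P : Polynomial ℂ)
    (hP : ∀ z : ℂ, Y0 < z.im → P.eval (jinv z) ≠ 0) :
    (∀ z : ℂ, z.im = Y → ContinuousAt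
      (fun z => jinv z ^ s * (P.derivative.eval (jinv z) / P.eval (jinv z) * deriv jinv z)) z) ∧
    Lint Y (fun z => jinv z ^ s * (P.derivative.eval (jinv z) / P.eval (jinv z) * deriv jinv z))
      = -(2 * π * Complex.I) * (P.roots.map fun x => x ^ s).sum := by
  have h := (Lint_roots h0 hY s P.roots (fun x hx z hz e => hP z hz (by
    rw [e]; exact (Polynomial.isRoot_of_mem_roots hx)))).2
  refine ⟨?_, ?_⟩
  · intro z hz
    have hz0 : 0 < z.im := by rw [hz]; exact h0.trans_lt hY
    have hj := (jinv_diff z hz0).continuousAt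
    have c1 : ContinuousAt (fun z => P.derivative.eval (jinv z)) z :=
      ContinuousAt.comp (f := jinv) (P.derivative.continuous.continuousAt) hj
    have c2 : ContinuousAt (fun z => P.eval (jinv z)) z :=
      ContinuousAt.comp (f := jinv) (P.continuous.continuousAt) hj
    exact (hj.pow s).mul ((c1.div c2 (hP z (by rw [hz]; exact hY))).mul
      (diff_deriv (Y0 := 0) jinv_diff z hz0).continuousAt)
  · rw [← h]
    apply Lint_congr
    intro z hz
    rw [Polynomial.Splits.eval_derivative_div_eval_of_ne_zero (IsAlgClosed.splits P)
      (hP z (by rw [hz]; exact hY)), Multiset.sum_map_mul_left, ← Multiset.sum_map_mul_right]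
    congr 1
    congr 1
    apply Multiset.map_congr rfl
    intro x _
    ring

lemma miller_q {ℓ m : ℕ} (hm : m ≤ ℓ) {f : ℂ → ℂ} {a : ℕ → ℂ}
    (ha : ∀ z : ℂ, 0 < z.im →
      Summable (fun n : ℕ => a n * qexp z ^ n) ∧ f z = ∑' n : ℕ, a n * qexp z ^ n)
    (hd : ∀ d : ℕ, d ≤ ℓ → a d = if d = m then 1 else 0) :
    ∃ r : ℝ, 0 < r ∧ ∃ ψ : ℂ → ℂ, DifferentiableOn ℂ ψ (Metric.ball 0 r) ∧
      ∀ z : ℂ, 0 < z.im →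
        f z = qexp z ^ m * (1 + qexp z ^ (ℓ + 1 - m) * ψ (qexp z)) := by
  refine ⟨‖qexp Complex.I‖, norm_pos_iff.2 (qexp_ne _),
    fun w => ∑' n : ℕ, a (n + (ℓ + 1)) * w ^ n, ?_, ?_⟩
  · set r := ‖qexp Complex.I‖ with hr
    have hr0 : 0 < r := norm_pos_iff.2 (qexp_ne _)
    have hs : Summable (fun n : ℕ => ‖a n‖ * r ^ n) := by
      have := (ha Complex.I (by simp)).1.norm
      simpa [norm_mul, norm_pow] using this
    have hs2 : Summable (fun n : ℕ => ‖a (n + (ℓ + 1))‖ * r ^ n) := by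
      have h1 := ((summable_nat_add_iff (ℓ + 1)).2 hs).mul_right ((r ^ (ℓ + 1))⁻¹)
      refine h1.congr (fun n => ?_)
      rw [pow_add]
      field_simp
    apply differentiableOn_tsum_of_summable_norm hs2 _ Metric.isOpen_ball
    · intro n w hw
      rw [norm_mul, norm_pow]
      have : ‖w‖ ≤ r := by simpa using (mem_ball_zero_iff.1 hw).le
      gcongr
    · intro n
      fun_prop
  · intro z hz
    obtain ⟨h1, h2⟩ := ha z hz
    rw [h2, ← h1.sum_add_tsum_nat_add (ℓ + 1)]
    have e1 : ∑ i ∈ Finset.range (ℓ + 1), a i * qexp z ^ i = qexp z ^ m := by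
      rw [Finset.sum_eq_single m]
      · rw [hd m hm]; simp
      · intro b hb hbm
        rw [hd b (by simpa [Nat.lt_succ_iff] using hb), if_neg hbm, zero_mul]
      · intro h; simp at h; omega
    have e2 : ∑' i : ℕ, a (i + (ℓ + 1)) * qexp z ^ (i + (ℓ + 1))
        = qexp z ^ (ℓ + 1) * ∑' n : ℕ, a (n + (ℓ + 1)) * qexp z ^ n := by
      rw [← tsum_mul_left]
      congr 1; ext i; ring
    rw [e1, e2, mul_add, mul_one, ← mul_assoc, ← pow_add, Nat.add_sub_cancel' (by omega)]

lemma miller_log {ℓ m : ℕ} (hm : m ≤ ℓ) {f : ℂ → ℂ} {r : ℝ} (hr : 0 < r) {ψ : ℂ → ℂ}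
    (hψ : DifferentiableOn ℂ ψ (Metric.ball 0 r))
    (hf : ∀ z : ℂ, 0 < z.im →
        f z = qexp z ^ m * (1 + qexp z ^ (ℓ + 1 - m) * ψ (qexp z))) :
    ∃ Y0 : ℝ, 0 ≤ Y0 ∧ (∀ z : ℂ, Y0 < z.im → f z ≠ 0) ∧
      ∀ s : ℕ, s ≤ ℓ - m → Tendsto (fun z => jinv z ^ s * (deriv f z / f z - 2 * π * Complex.I * m))
        (comap Complex.im atTop) (𝓝 0) := by
  obtain ⟨H, hH, H0, hj⟩ := jinv_H
  obtain ⟨e, he⟩ : ∃ e, ℓ + 1 - m = e + 1 := ⟨ℓ - m, by omega⟩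
  have he' : ℓ - m = e := by omega
  rw [he] at hf
  rw [he']
  have hb : Metric.ball (0 : ℂ) 1 ∈ 𝓝 (0 : ℂ) := Metric.ball_mem_nhds _ one_pos
  have hbr : Metric.ball (0 : ℂ) r ∈ 𝓝 (0 : ℂ) := Metric.ball_mem_nhds _ hr
  have hHc : ContinuousAt H 0 := (hH.differentiableAt hb).continuousAt
  have hψc : ContinuousAt ψ 0 := (hψ.differentiableAt hbr).continuousAt
  have hψ'c : ContinuousAt (deriv ψ) 0 :=
    ((hψ.deriv Metric.isOpen_ball).differentiableAt hbr).continuousAt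
  have huc : ContinuousAt (fun w => 1 + w ^ (e + 1) * ψ w) 0 := by fun_prop
  have hq0 : Tendsto qexp (comap Complex.im atTop) (𝓝 0) :=
    qexp_tendsto.mono_right nhdsWithin_le_nhds
  have hune : ∀ᶠ z in comap Complex.im atTop, 1 + qexp z ^ (e + 1) * ψ (qexp z) ≠ 0 ∧
      qexp z ∈ Metric.ball (0 : ℂ) r := by
    apply hq0.eventually (p := fun w => 1 + w ^ (e + 1) * ψ w ≠ 0 ∧ w ∈ Metric.ball (0 : ℂ) r)
    exact (huc.eventually_ne (by simp)).and hbr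
  obtain ⟨Y1, hY1⟩ : ∃ Y1 : ℝ, ∀ z : ℂ, Y1 < z.im → 1 + qexp z ^ (e + 1) * ψ (qexp z) ≠ 0 ∧
      qexp z ∈ Metric.ball (0 : ℂ) r := by
    rw [eventually_comap, eventually_atTop] at hune
    obtain ⟨Y1, h⟩ := hune
    exact ⟨Y1, fun z hz => h z.im hz.le z rfl⟩
  refine ⟨max Y1 0, le_max_right _ _, ?_, ?_⟩
  · intro z hz
    rw [hf z ((le_max_right _ _).trans_lt hz)]
    exact mul_ne_zero (pow_ne_zero _ (qexp_ne z)) (hY1 z ((le_max_left _ _).trans_lt hz)).1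
  · intro s hs
    have hc : ContinuousAt (fun w => H w ^ s * w ^ (e - s + 1) * (2 * π * Complex.I) *
        (((e + 1 : ℕ) : ℂ) * ψ w + w * deriv ψ w) / (1 + w ^ (e + 1) * ψ w)) 0 := by
      apply ContinuousAt.div
      · fun_prop
      · exact huc
      · simp
    have := tendsto_of_q (g := fun z => jinv z ^ s * (deriv f z / f z - 2 * π * Complex.I * m))
      hc (max Y1 0) (fun z hz => ?_)
    · simpa using this
    · have hz0 : 0 < z.im := (le_max_right _ _).trans_lt hz
      obtain ⟨hu, hzr⟩ := hY1 z ((le_max_left _ _).trans_lt hz)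
      have hq := qexp_ne z
      have hψz := (hψ.differentiableAt (Metric.isOpen_ball.mem_nhds hzr)).hasDerivAt.comp z
        (qexp_deriv z)
      have hder : HasDerivAt (fun z => qexp z ^ m * (1 + qexp z ^ (e + 1) * ψ (qexp z))) _ z :=
        ((qexp_deriv z).pow m).mul ((((qexp_deriv z).pow (e + 1)).mul hψz).const_add 1)
      have ee : f =ᶠ[𝓝 z] (fun z => qexp z ^ m * (1 + qexp z ^ (e + 1) * ψ (qexp z))) := by
        filter_upwards [uhp_nhds hz0] with w hw using hf w hw
      rw [ee.deriv_eq, hder.deriv, hf z hz0, hj z hz0]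
      simp only [Function.comp_apply, Pi.mul_apply, Pi.pow_apply, Nat.add_sub_cancel]
      obtain ⟨t, rfl⟩ := Nat.exists_eq_add_of_le hs
      rw [Nat.add_sub_cancel_left]
      have hmm : (m : ℂ) * qexp z ^ (m - 1) * (2 * π * Complex.I * qexp z)
          = m * (2 * π * Complex.I) * qexp z ^ m := by
        rcases Nat.eq_zero_or_pos m with h | h
        · subst h; simp
        · obtain ⟨n, rfl⟩ := Nat.exists_eq_add_of_le' h
          rw [Nat.add_sub_cancel]; ring
      rw [hmm]
      generalize deriv ψ (qexp z) = p at *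
      generalize ψ (qexp z) = v at *
      generalize H (qexp z) = h at *
      generalize qexp z = q at *
      rw [div_pow, div_mul_eq_mul_div, eq_div_iff hu, div_mul_eq_mul_div, div_eq_iff (by positivity)]
      field_simp
      push_cast
      ring

lemma E4_cube (z : ℂ) (hz : 0 < z.im) : Eis 4 z ^ 3 = Disc z * jinv z := by
  rw [jinv, mul_div_cancel₀ _ (Disc_ne z hz)]

lemma E6_sq_j (z : ℂ) (hz : 0 < z.im) : Eis 6 z ^ 2 = Disc z * (jinv z - 1728) := by
  rw [E6_sq z hz, E4_cube z hz]; ring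

lemma Eis_pow12 (k' : ℕ) (hk' : k' = 0 ∨ k' = 4 ∨ k' = 6 ∨ k' = 8 ∨ k' = 10 ∨ k' = 14) :
    ∃ a b : ℕ, (∀ s : ℕ, Ccoef s k' = -(b : ℂ) * 1728 ^ s / 2) ∧
      ∀ z : ℂ, 0 < z.im → Eis k' z ^ 12 = Disc z ^ k' * (jinv z ^ (4 * a) * (jinv z - 1728) ^ (6 * b)) := by
  rcases hk' with rfl | rfl | rfl | rfl | rfl | rfl
  · refine ⟨0, 0, fun s => by simp [Ccoef], fun z hz => by simp [Eis]⟩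
  · refine ⟨1, 0, fun s => by simp [Ccoef], fun z hz => ?_⟩
    have h4 := E4_cube z hz
    rw [show Eis 4 z ^ 12 = (Eis 4 z ^ 3) ^ 4 by ring, h4]; ring
  · refine ⟨0, 1, fun s => by simp [Ccoef], fun z hz => ?_⟩
    have h6 := E6_sq_j z hz
    rw [show Eis 6 z ^ 12 = (Eis 6 z ^ 2) ^ 6 by ring, h6]; ring
  · refine ⟨2, 0, fun s => by simp [Ccoef], fun z hz => ?_⟩
    have h4 := E4_cube z hz
    rw [E8_eq z hz, show (Eis 4 z ^ 2) ^ 12 = (Eis 4 z ^ 3) ^ 8 by ring, h4]; ring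
  · refine ⟨1, 1, fun s => by simp [Ccoef], fun z hz => ?_⟩
    have h4 := E4_cube z hz
    have h6 := E6_sq_j z hz
    rw [E10_eq z hz, show (Eis 4 z * Eis 6 z) ^ 12 = (Eis 4 z ^ 3) ^ 4 * (Eis 6 z ^ 2) ^ 6 by ring,
      h4, h6]; ring
  · refine ⟨2, 1, fun s => by simp [Ccoef], fun z hz => ?_⟩
    have h4 := E4_cube z hz
    have h6 := E6_sq_j z hz
    rw [E14_eq z hz,
      show (Eis 4 z ^ 2 * Eis 6 z) ^ 12 = (Eis 4 z ^ 3) ^ 8 * (Eis 6 z ^ 2) ^ 6 by ring,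
      h4, h6]; ring

lemma Lint_j (s : ℕ) : Lint 1 (fun z => jinv z ^ s) = cj s 0 := by
  simp [Lint, cj, qCoeff]

lemma powerSum_formula (ℓ k' m : ℕ)
    (hk' : k' = 0 ∨ k' = 4 ∨ k' = 6 ∨ k' = 8 ∨ k' = 10 ∨ k' = 14)
    (hm : m ≤ ℓ) (f : ℂ → ℂ) (F : Polynomial ℂ)
    (hf : IsMillerForm ℓ k' m f) (hF : IsFaber ℓ k' m f F) (s : ℕ) (hs : 1 ≤ s) (hsl : s ≤ ℓ - m) :
    powerSumRoots F s = Acoef s * ((12 * ℓ + k' : ℕ) : ℂ) + Bcoef s * (m : ℂ) + Ccoef s k' := by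
  obtain ⟨fd, fT, -, a, ha, hd⟩ := hf
  obtain ⟨Fm, -, hfF⟩ := hF
  obtain ⟨r, hr, ψ, hψ, hfq⟩ := miller_q hm ha hd
  obtain ⟨Y0, h0, hne, hlim⟩ := miller_log hm hr hψ hfq
  obtain ⟨u, b, hC, hE⟩ := Eis_pow12 k' hk'
  set k := 12 * ℓ + k' with hk
  set P : Polynomial ℂ := F ^ 12 * (X ^ (4 * u) * (X - Polynomial.C 1728) ^ (6 * b)) with hP
  have hPm : P ≠ 0 := by
    have : P.Monic := (Fm.pow 12).mul ((monic_X_pow _).mul ((monic_X_sub_C _).pow _))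
    exact this.ne_zero
  have hf12 : ∀ z : ℂ, 0 < z.im → f z ^ 12 = Disc z ^ k * P.eval (jinv z) := by
    intro z hz
    rw [hfF z hz, mul_pow, mul_pow, hE z hz, hP, hk]
    simp only [eval_mul, eval_pow, eval_X, eval_sub, eval_C]
    ring
  have hPne : ∀ z : ℂ, Y0 < z.im → P.eval (jinv z) ≠ 0 := by
    intro z hz h
    have := hf12 z (h0.trans_lt hz)
    rw [h, mul_zero] at this
    exact hne z hz (pow_eq_zero_iff (by norm_num) |>.1 this)
  obtain ⟨Y, hY⟩ : ∃ Y, Y0 < Y := ⟨Y0 + 1, by linarith⟩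
  have hY' : 0 < Y := h0.trans_lt hY
  -- logarithmic derivative
  have hlog : ∀ z : ℂ, Y0 < z.im → 12 * (deriv f z / f z) = k * Wd z +
      P.derivative.eval (jinv z) / P.eval (jinv z) * deriv jinv z := by
    intro z hz
    have hz0 := h0.trans_lt hz
    have h1 := (fd z hz0).hasDerivAt.pow 12
    have hcomp : HasDerivAt (fun z => P.eval (jinv z)) (P.derivative.eval (jinv z) * deriv jinv z) z :=
      (P.hasDerivAt (jinv z)).comp z (jinv_diff z hz0).hasDerivAt
    have h2 : HasDerivAt (fun z => Disc z ^ k * P.eval (jinv z)) _ z :=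
      ((Disc_diff z hz0).hasDerivAt.pow k).mul hcomp
    have e : f ^ 12 =ᶠ[𝓝 z] (fun z => Disc z ^ k * P.eval (jinv z)) := by
      filter_upwards [uhp_nhds hz0] with w hw using hf12 w hw
    have h3 := (h1.congr_of_eventuallyEq e.symm).unique h2
    have h4 := hf12 z hz0
    have n1 := hne z hz
    have n2 := hPne z hz
    have n3 := Disc_ne z hz0
    simp only [Pi.pow_apply] at h3
    have hkk : (k : ℂ) * Disc z ^ (k - 1) * Disc z = k * Disc z ^ k := by
      rcases Nat.eq_zero_or_pos k with h | h
      · rw [h]; simp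
      · obtain ⟨n, hn⟩ := Nat.exists_eq_add_of_le' h
        rw [hn, Nat.add_sub_cancel]; ring
    rw [Wd]
    have h5 : 12 * (deriv f z / f z) = (((12 : ℕ) : ℂ) * f z ^ (12 - 1) * deriv f z) / f z ^ 12 := by
      field_simp; push_cast; ring
    rw [h5, h3, h4]
    have n4 : Disc z ^ k ≠ 0 := pow_ne_zero _ n3
    field_simp
    linear_combination (deriv Disc z * P.eval (jinv z)) * hkk
  -- the two evaluations of the period integral
  have hcj : ∀ z : ℂ, 0 < z.im → DifferentiableAt ℂ (fun z => jinv z ^ s) z :=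
    fun z hz => (jinv_diff z hz).pow s
  have hfl : ∀ z : ℂ, Y0 < z.im → DifferentiableAt ℂ
      (fun z => jinv z ^ s * (deriv f z / f z - 2 * π * Complex.I * m)) z := fun z hz =>
    (hcj z (h0.trans_lt hz)).mul (((diff_deriv (Y0 := 0) fd z (h0.trans_lt hz)).div
      (fd z (h0.trans_lt hz)) (hne z hz)).sub_const _)
  have I1 : Lint Y (fun z => jinv z ^ s * (deriv f z / f z - 2 * π * Complex.I * m)) = 0 := by
    apply Lint_const hfl _ (hlim s hsl) hY
    intro z hz
    have hz0 := h0.trans_lt hz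
    rw [jinv_T z hz0, fT z hz0, deriv_periodic (Y0 := 0) fT z hz0]
  have I2 : Lint Y (fun z => jinv z ^ s) = cj s 0 := by
    rw [← Lint_j]
    exact Lint_shift hcj (fun z hz => by rw [jinv_T z hz]) hY' one_pos
  have I3 : Lint Y (fun z => jinv z ^ s * Wd z) = 24 * π * Complex.I * Acoef s := by
    rw [← Lint_Wd]
    exact Lint_shift (fun z hz => (hcj z hz).mul (Wd_diff z hz))
      (fun z hz => by simp only [Pi.mul_apply, jinv_T z hz, Wd_T z hz]) hY' one_pos
  obtain ⟨hc4, I4⟩ := Lint_poly h0 hY s P hPne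
  have key : 12 * Lint Y (fun z => jinv z ^ s * (deriv f z / f z - 2 * π * Complex.I * m))
      + (12 * (2 * π * Complex.I * m)) * Lint Y (fun z => jinv z ^ s)
      = k * Lint Y (fun z => jinv z ^ s * Wd z) + Lint Y (fun z => jinv z ^ s *
        (P.derivative.eval (jinv z) / P.eval (jinv z) * deriv jinv z)) := by
    rw [← Lint_smul, ← Lint_smul, ← Lint_smul, ← Lint_add, ← Lint_add]
    · apply Lint_congr
      intro z hz
      have := hlog z (by rw [hz]; exact hY)
      linear_combination (jinv z ^ s) * this
    · intro z hz
      have hz0 : 0 < z.im := by rw [hz]; exact hY'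
      exact continuousAt_const.mul ((hcj z hz0).mul (Wd_diff z hz0)).continuousAt
    · exact hc4
    · intro z hz
      exact continuousAt_const.mul (hfl z (by rw [hz]; exact hY)).continuousAt
    · intro z hz
      exact continuousAt_const.mul (hcj z (by rw [hz]; exact hY')).continuousAt
  have hroots : (P.roots.map fun x => x ^ s).sum
      = 12 * powerSumRoots F s + 6 * b * 1728 ^ s := by
    rw [hP] at hPm
    have hPm2 := right_ne_zero_of_mul hPm
    rw [hP, roots_mul hPm, roots_mul hPm2, roots_pow, roots_X_pow, roots_pow, roots_X_sub_C]
    simp only [Multiset.map_add, Multiset.sum_add, Multiset.map_nsmul, Multiset.sum_nsmul,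
      Multiset.map_singleton, Multiset.sum_singleton, zero_pow (by omega : s ≠ 0)]
    simp [powerSumRoots]
  rw [I1, I2, I3, I4, hroots] at key
  have hpi : (π : ℂ) ≠ 0 := by exact_mod_cast Real.pi_ne_zero
  have hI : (2 * π * Complex.I : ℂ) ≠ 0 := by simp [hpi]
  rw [hC, Bcoef]
  have h12 : (2 * π * Complex.I) * (12 * powerSumRoots F s) =
      (2 * π * Complex.I) * (12 * (Acoef s * (k : ℂ) + -cj s 0 * (m : ℂ) + -(b : ℂ) * 1728 ^ s / 2)) := by
    linear_combination key
  have := mul_left_cancel₀ hI h12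
  exact mul_left_cancel₀ (by norm_num : (12 : ℂ) ≠ 0) this

/-- Functions `d : Fin N → ℕ` with `∑ (t+1) d_t = n`. -/
def solsN (N n : ℕ) : Finset (Fin N → ℕ) :=
  (Fintype.piFinset fun _ : Fin N => Finset.range (n + 1)).filter
    (fun d => ∑ t : Fin N, ((t : ℕ) + 1) * d t = n)

lemma mem_solsN {N n : ℕ} {d : Fin N → ℕ} :
    d ∈ solsN N n ↔ ∑ t : Fin N, ((t : ℕ) + 1) * d t = n := by
  rw [solsN, Finset.mem_filter]
  refine ⟨fun h => h.2, fun h => ⟨?_, h⟩⟩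
  rw [Fintype.mem_piFinset]
  intro t
  have : ((t : ℕ) + 1) * d t ≤ n := by
    rw [← h]
    exact Finset.single_le_sum (f := fun t : Fin N => ((t : ℕ) + 1) * d t)
      (fun _ _ => Nat.zero_le _) (Finset.mem_univ t)
  rw [Finset.mem_range]
  nlinarith

/-- Weight of a solution. -/
def wt (p : ℕ → ℂ) {N : ℕ} (d : Fin N → ℕ) : ℂ :=
  ∏ s : Fin N, (-1 : ℂ) ^ (d s) * p ((s : ℕ) + 1) ^ (d s)
    / ((Nat.factorial (d s) : ℂ) * ((s : ℕ) + 1 : ℂ) ^ (d s))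

lemma wt_update (p : ℕ → ℂ) {N : ℕ} (d : Fin N → ℕ) (s : Fin N) :
    ((s : ℕ) + 1 : ℂ) * (((d s + 1 : ℕ) : ℂ) * wt p (Function.update d s (d s + 1)))
      = -p ((s : ℕ) + 1) * wt p d := by
  unfold wt
  rw [← Finset.mul_prod_erase Finset.univ _ (Finset.mem_univ s),
    ← Finset.mul_prod_erase Finset.univ (fun t : Fin N => (-1 : ℂ) ^ (d t) * p ((t : ℕ) + 1) ^ (d t)
    / ((Nat.factorial (d t) : ℂ) * ((t : ℕ) + 1 : ℂ) ^ (d t))) (Finset.mem_univ s)]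
  have e : ∏ t ∈ Finset.univ.erase s, ((-1 : ℂ) ^ (Function.update d s (d s + 1) t) *
      p ((t : ℕ) + 1) ^ (Function.update d s (d s + 1) t)
      / ((Nat.factorial (Function.update d s (d s + 1) t) : ℂ) *
        ((t : ℕ) + 1 : ℂ) ^ (Function.update d s (d s + 1) t)))
      = ∏ t ∈ Finset.univ.erase s, ((-1 : ℂ) ^ (d t) * p ((t : ℕ) + 1) ^ (d t)
    / ((Nat.factorial (d t) : ℂ) * ((t : ℕ) + 1 : ℂ) ^ (d t))) := by
    apply Finset.prod_congr rfl
    intro t ht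
    rw [Function.update_of_ne (Finset.ne_of_mem_erase ht)]
  rw [e]
  simp only [Function.update_self]
  generalize (∏ t ∈ Finset.univ.erase s, ((-1 : ℂ) ^ (d t) * p ((t : ℕ) + 1) ^ (d t)
    / ((Nat.factorial (d t) : ℂ) * ((t : ℕ) + 1 : ℂ) ^ (d t)))) = R
  have h1 : ((s : ℕ) + 1 : ℂ) ≠ 0 := Nat.cast_add_one_ne_zero _
  have h2 : ((d s : ℂ) + 1) ≠ 0 := Nat.cast_add_one_ne_zero _
  have h3 : (Nat.factorial (d s) : ℂ) ≠ 0 := by exact_mod_cast Nat.factorial_ne_zero _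
  rw [Nat.factorial_succ]
  push_cast
  field_simp
  ring

lemma sum_update {N : ℕ} (d : Fin N → ℕ) (s : Fin N) :
    ∑ t : Fin N, ((t : ℕ) + 1) * Function.update d s (d s + 1) t
      = ∑ t : Fin N, ((t : ℕ) + 1) * d t + (s + 1) := by
  rw [← Finset.add_sum_erase Finset.univ _ (Finset.mem_univ s),
    ← Finset.add_sum_erase Finset.univ (fun t : Fin N => ((t : ℕ) + 1) * d t) (Finset.mem_univ s)]
  have e : ∑ t ∈ Finset.univ.erase s, ((t : ℕ) + 1) * Function.update d s (d s + 1) t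
      = ∑ t ∈ Finset.univ.erase s, ((t : ℕ) + 1) * d t := by
    apply Finset.sum_congr rfl
    intro t ht
    rw [Function.update_of_ne (Finset.ne_of_mem_erase ht)]
  rw [e]
  simp only [Function.update_self]
  ring

lemma hsum_step (p : ℕ → ℂ) {N n : ℕ} (s : Fin N) :
    ∑ d ∈ solsN N n, (((s : ℕ) + 1 : ℂ) * ((d s : ℂ) * wt p d))
      = if (s : ℕ) < n then -p ((s : ℕ) + 1) * ∑ d ∈ solsN N (n - 1 - s), wt p d else 0 := by
  split_ifs with h
  · rw [Finset.mul_sum, ← Finset.sum_filter_of_ne (p := fun d => d s ≠ 0)]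
    · symm
      refine Finset.sum_bij' (fun d _ => Function.update d s (d s + 1))
        (fun d _ => Function.update d s (d s - 1)) ?_ ?_ ?_ ?_ ?_
      · intro d hd
        rw [Finset.mem_filter, mem_solsN, sum_update, mem_solsN.1 hd]
        exact ⟨by omega, by simp⟩
      · intro d hd
        rw [Finset.mem_filter, mem_solsN] at hd
        obtain ⟨h1, h2⟩ := hd
        have := sum_update (Function.update d s (d s - 1)) s
        rw [Function.update_self, Function.update_idem, Nat.sub_add_cancel (by omega),
          Function.update_eq_self, h1] at this
        rw [mem_solsN]
        omega
      · intro d hd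
        simp
      · intro d hd
        rw [Finset.mem_filter] at hd
        rw [Function.update_self, Function.update_idem, Nat.sub_add_cancel (by omega),
          Function.update_eq_self]
      · intro d hd
        rw [← wt_update, Function.update_self]
    · intro d hd hne h0
      apply hne
      simp [h0]
  · apply Finset.sum_eq_zero
    intro d hd
    have h1 := mem_solsN.1 hd
    have : ((s : ℕ) + 1) * d s ≤ n := by
      rw [← h1]
      exact Finset.single_le_sum (f := fun t : Fin N => ((t : ℕ) + 1) * d t)
        (fun _ _ => Nat.zero_le _) (Finset.mem_univ s)
    have h0 : d s = 0 := by
      by_contra hne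
      have : 1 ≤ d s := Nat.one_le_iff_ne_zero.2 hne
      nlinarith
    simp [h0]

lemma hsum_rec (p : ℕ → ℂ) {N n : ℕ} (hn : n ≤ N) :
    (n : ℂ) * ∑ d ∈ solsN N n, wt p d
      = -∑ s ∈ Finset.range n, p (s + 1) * ∑ d ∈ solsN N (n - 1 - s), wt p d := by
  have e1 : (n : ℂ) * ∑ d ∈ solsN N n, wt p d
      = ∑ s : Fin N, ∑ d ∈ solsN N n, (((s : ℕ) + 1 : ℂ) * ((d s : ℂ) * wt p d)) := by
    rw [Finset.sum_comm, Finset.mul_sum]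
    apply Finset.sum_congr rfl
    intro d hd
    have h1 := mem_solsN.1 hd
    have h2 : (n : ℂ) = ∑ t : Fin N, ((t : ℕ) + 1 : ℂ) * (d t : ℂ) := by
      rw [← h1]; push_cast; rfl
    rw [h2, Finset.sum_mul]
    apply Finset.sum_congr rfl
    intro t _
    ring
  rw [e1]
  simp only [hsum_step]
  rw [Fin.sum_univ_eq_sum_range (fun s => if s < n then -p (s + 1) * ∑ d ∈ solsN N (n - 1 - s), wt p d
    else 0) N, ← Finset.sum_subset (Finset.range_subset_range.2 hn), ← Finset.sum_neg_distrib]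
  · apply Finset.sum_congr rfl
    intro s hs
    rw [if_pos (Finset.mem_range.1 hs)]
    ring
  · intro s _ hs
    rw [if_neg (by simpa using hs)]

lemma hsum_zero (p : ℕ → ℂ) (N : ℕ) : ∑ d ∈ solsN N 0, wt p d = 1 := by
  have : solsN N 0 = {fun _ => 0} := by
    ext d
    rw [mem_solsN, Finset.mem_singleton]
    simp [funext_iff]
  rw [this, Finset.sum_singleton]
  simp [wt]

lemma newton_multiset (S : Multiset ℂ) (n : ℕ) :
    (n : ℂ) * S.esymm n = (-1) ^ (n + 1) * ∑ s ∈ Finset.range n,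
      (-1) ^ (n - 1 - s) * S.esymm (n - 1 - s) * (S.map fun x => x ^ (s + 1)).sum := by
  obtain ⟨l, rfl⟩ := Quot.exists_rep S
  change (n : ℂ) * (Multiset.ofList l).esymm n = (-1) ^ (n + 1) * ∑ s ∈ Finset.range n,
      (-1) ^ (n - 1 - s) * (Multiset.ofList l).esymm (n - 1 - s) *
        ((Multiset.ofList l).map fun x => x ^ (s + 1)).sum
  have hl : (Multiset.ofList l) = Finset.univ.val.map l.get := by
    rw [Fin.univ_val_map, List.ofFn_get]
  have h := congrArg (MvPolynomial.aeval l.get) (MvPolynomial.mul_esymm_eq_sum (Fin l.length) ℂ n)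
  have hp : ∀ i, MvPolynomial.aeval l.get (MvPolynomial.psum (Fin l.length) ℂ i)
      = ((Multiset.ofList l).map fun x => x ^ i).sum := by
    intro i
    rw [hl, MvPolynomial.psum, map_sum, Multiset.map_map]
    simp only [map_pow, MvPolynomial.aeval_X]
    rfl
  simp only [map_mul, map_sum, map_pow, map_neg, map_one, map_natCast,
    MvPolynomial.aeval_esymm_eq_multiset_esymm, hp, ← hl] at h
  rw [h]
  congr 1
  rw [Finset.sum_filter, Finset.Nat.sum_antidiagonal_eq_sum_range_succ
    (fun i j => if i < n then (-1 : ℂ) ^ i * (Multiset.ofList l).esymm i *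
      ((Multiset.ofList l).map fun x => x ^ j).sum else 0) n, Finset.sum_range_succ,
    if_neg (lt_irrefl n), add_zero, ← Finset.sum_range_reflect]
  apply Finset.sum_congr rfl
  intro s hs
  have hs' := Finset.mem_range.1 hs
  rw [if_pos (by omega), show n - (n - 1 - s) = s + 1 by omega]

lemma coeff_rec (F : Polynomial ℂ) (hF : F.Monic) (n : ℕ) (hn : n ≤ F.natDegree) :
    (n : ℂ) * F.coeff (F.natDegree - n) = -∑ s ∈ Finset.range n,
      powerSumRoots F (s + 1) * F.coeff (F.natDegree - (n - 1 - s)) := by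
  have hc : ∀ i ≤ F.natDegree, F.coeff (F.natDegree - i) = (-1) ^ i * F.roots.esymm i := by
    intro i hi
    rw [Polynomial.coeff_eq_esymm_roots_of_card (IsAlgClosed.card_roots_eq_natDegree)
      (Nat.sub_le _ _), hF.leadingCoeff, one_mul, Nat.sub_sub_self hi]
  rw [hc n hn, mul_left_comm, newton_multiset, ← mul_assoc, ← pow_add,
    show n + (n + 1) = 2 * n + 1 by ring, pow_succ, pow_mul]
  simp only [even_two, Even.neg_pow, one_pow, one_mul, neg_mul, one_mul, neg_inj]
  apply Finset.sum_congr rfl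
  intro s hs
  rw [hc _ (by omega), powerSumRoots]
  ring

lemma coeff_eq_hsum (F : Polynomial ℂ) (hF : F.Monic) (p : ℕ → ℂ) (N : ℕ) (hN : N ≤ F.natDegree)
    (hp : ∀ s : ℕ, 1 ≤ s → s ≤ N → powerSumRoots F s = p s) (n : ℕ) (hn : n ≤ N) :
    F.coeff (F.natDegree - n) = ∑ d ∈ solsN N n, wt p d := by
  induction n using Nat.strong_induction_on with
  | _ n ih =>
    rcases Nat.eq_zero_or_pos n with h | h
    · subst h
      rw [hsum_zero, Nat.sub_zero]
      exact hF
    · have h0 : (n : ℂ) ≠ 0 := by exact_mod_cast h.ne'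
      apply mul_left_cancel₀ h0
      rw [coeff_rec F hF n (hn.trans hN), hsum_rec p hn]
      congr 1
      apply Finset.sum_congr rfl
      intro s hs
      have hs' := Finset.mem_range.1 hs
      rw [hp (s + 1) (by omega) (by omega), ih (n - 1 - s) (by omega) (by omega)]

/-- Writing the Faber polynomial as
`F_{k,m}(t) = t^{ℓ-m} + e_1 t^{ℓ-m-1} + ⋯ + e_{ℓ-m}`, for every `1 ≤ n ≤ ℓ - m`,
`e_n = ∑_{t_1 + 2t_2 + ⋯ + n t_n = n} ∏_{s=1}^n (-1)^{t_s}
(A_s k + B_s m + C_s(k'))^{t_s} / (t_s! s^{t_s})`.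
(Index `s : Fin n` below stands for the index `s + 1 ∈ {1,…,n}`.) -/
theorem faber_coeff_formula (ℓ k' m : ℕ)
    (hk' : k' = 0 ∨ k' = 4 ∨ k' = 6 ∨ k' = 8 ∨ k' = 10 ∨ k' = 14)
    (hm : m ≤ ℓ)
    (f : ℂ → ℂ) (F : Polynomial ℂ)
    (hf : IsMillerForm ℓ k' m f) (hF : IsFaber ℓ k' m f F) :
    ∀ n : ℕ, 1 ≤ n → n ≤ ℓ - m →
      F.coeff (ℓ - m - n)
        = ∑ d ∈ sols n, ∏ s : Fin n,
            (-1 : ℂ) ^ (d s) *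
              (Acoef ((s : ℕ) + 1) * ((12 * ℓ + k' : ℕ) : ℂ)
                + Bcoef ((s : ℕ) + 1) * (m : ℂ) + Ccoef ((s : ℕ) + 1) k') ^ (d s)
            / ((Nat.factorial (d s) : ℂ) * ((s : ℕ) + 1 : ℂ) ^ (d s)) := by
  intro n hn1 hn
  have hdeg := hF.2.1
  have h := coeff_eq_hsum F hF.1 (fun s => Acoef s * ((12 * ℓ + k' : ℕ) : ℂ)
    + Bcoef s * (m : ℂ) + Ccoef s k') n (by rw [hdeg]; exact hn)
    (fun s hs hsn => powerSum_formula ℓ k' m hk' hm f F hf hF s hs (hsn.trans hn)) n le_rfl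
  rw [hdeg] at h
  exact h
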